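/- Let u be the simple Parry word associated with the substitution φ, and let R_s = m−1 if α_0 ≥ 2 and R_s = m + ℓ′ − 1 with ℓ′ = min{ℓ ≥ 1 : α_ℓ ≥ 1} if α_0 = 1. Let k, K, n, Q, q ∈ ℕ satisfy n ≤ F_{k+K}, Q ≤ F_K and u_[n] = φ^k(u_[Q])·u_[q]. Suppose nonempty finite words z_0, …, z_h and z̃_0, …, z̃_h satisfy: φ^{K+R_s}(0) = z_0 ⋯ z_h; the word obtained from φ^{K+R_s}(0)·u_[Q] by deleting its first Q letters equals z̃_0 ⋯ z̃_h; Ψ(z_j) = Ψ(z̃_j) for every j; and u_[q] is a prefix of φ^k(z̃_j) for every j. For each j, let w_j be the word obtained from φ^k(z̃_j)·u_[q] by deleting its first q letters. Then φ^{k+K+R_s}(0) = φ^k(z_0) ⋯ φ^k(z_h), the word obtained from φ^{k+K+R_s}(0)·u_[n] by deleting its first n letters equals w_0 ⋯ w_h, Ψ(φ^k(z_j)) = Ψ(w_j) for every j, and consequently P^rel_u(n) = ⋃_{j=0}^{h} { Ψ(s) − Ψ(r) : r is a prefix of φ^k(z_j), s is a prefix of w_j, |r| = |s| }. -/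

import Mathlib

/-- The prefix of length `n` of the infinite word `u`. -/
def pref (u : ℕ → ℕ) (n : ℕ) : List ℕ := (List.range n).map u

/-- `w` is a factor of the infinite word `u`. -/
def IsFactor (u : ℕ → ℕ) (w : List ℕ) : Prop :=
  ∃ i : ℕ, w = (List.range w.length).map (fun j => u (i + j))

/-- The Parikh vector of `w`, viewed as a word over `{0, …, m-1}`. -/
def parikh (m : ℕ) (w : List ℕ) : Fin m → ℤ := fun ℓ => (w.count (ℓ : ℕ) : ℤ)

/-- The set of relative Parikh vectors of factors of `u` of length `n`. -/
def relParikhSet (m : ℕ) (u : ℕ → ℕ) (n : ℕ) : Set (Fin m → ℤ) :=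
  { v | ∃ w : List ℕ, IsFactor u w ∧ w.length = n ∧ v = parikh m w - parikh m (pref u n) }

/-- The extension of a substitution `φ` to finite words. -/
def substW (φ : ℕ → List ℕ) (w : List ℕ) : List ℕ := w.flatMap φ

/-- The `k`-th iterate of the substitution `φ`, applied to the word `w`. -/
def iterW (φ : ℕ → List ℕ) (k : ℕ) (w : List ℕ) : List ℕ := (substW φ)^[k] w

/-- The finite word `u(i) ⋯ u(i + n - 1)`. -/
def factorAt (u : ℕ → ℕ) (i n : ℕ) : List ℕ := (List.range n).map fun j => u (i + j)

@[simp] lemma length_factorAt (u : ℕ → ℕ) (i n : ℕ) : (factorAt u i n).length = n := by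
  simp [factorAt]

@[simp] lemma length_pref (u : ℕ → ℕ) (n : ℕ) : (pref u n).length = n := by
  simp [pref]

lemma pref_eq_factorAt (u : ℕ → ℕ) (n : ℕ) : pref u n = factorAt u 0 n := by
  simp [pref, factorAt]

lemma take_factorAt (u : ℕ → ℕ) (i a b : ℕ) :
    (factorAt u i a).take b = factorAt u i (min b a) := by
  apply List.ext_getElem <;> simp [factorAt]

lemma drop_factorAt (u : ℕ → ℕ) (i a b : ℕ) :
    (factorAt u i a).drop b = factorAt u (i + b) (a - b) := by
  apply List.ext_getElem <;> simp [factorAt, add_assoc]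

lemma pref_add (u : ℕ → ℕ) (i n : ℕ) : pref u (i + n) = pref u i ++ factorAt u i n := by
  rw [← List.take_append_drop i (pref u (i + n)), pref_eq_factorAt, take_factorAt, drop_factorAt,
    pref_eq_factorAt]
  simp

lemma pref_prefix_pref (u : ℕ → ℕ) {a b : ℕ} (hab : a ≤ b) : pref u a <+: pref u b := by
  obtain ⟨c, rfl⟩ := Nat.exists_eq_add_of_le hab
  exact ⟨_, (pref_add u a c).symm⟩

lemma eq_pref_of_prefix {u : ℕ → ℕ} {w : List ℕ} {n : ℕ} (hw : w <+: pref u n) :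
    w = pref u w.length := by
  have hle : w.length ≤ n := by simpa using hw.length_le
  conv_lhs => rw [List.prefix_iff_eq_take.1 hw]
  rw [pref_eq_factorAt, take_factorAt, min_eq_left hle, pref_eq_factorAt]

section Iterates

variable (φ : ℕ → List ℕ)

lemma substW_append (v w : List ℕ) : substW φ (v ++ w) = substW φ v ++ substW φ w := by
  simp [substW]

lemma iterW_nil (k : ℕ) : iterW φ k [] = [] := by
  induction k with
  | zero => rfl
  | succ k ih => simpa [iterW, substW] using ih

lemma iterW_append (k : ℕ) (v w : List ℕ) :
    iterW φ k (v ++ w) = iterW φ k v ++ iterW φ k w := by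
  induction k generalizing v w with
  | zero => rfl
  | succ k ih => simpa [iterW, substW_append] using ih (substW φ v) (substW φ w)

lemma iterW_add (a b : ℕ) (w : List ℕ) : iterW φ (a + b) w = iterW φ a (iterW φ b w) :=
  Function.iterate_add_apply _ _ _ _

lemma iterW_succ_singleton (k a : ℕ) : iterW φ (k + 1) [a] = iterW φ k (φ a) := by
  simp [iterW, substW]

lemma iterW_flatten (k : ℕ) (L : List (List ℕ)) :
    iterW φ k L.flatten = (L.map (iterW φ k)).flatten := by
  induction L with
  | nil => exact iterW_nil φ k
  | cons w L ih => simp [iterW_append, ih]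

lemma iterW_prefix (k : ℕ) {v w : List ℕ} (hvw : v <+: w) : iterW φ k v <+: iterW φ k w := by
  obtain ⟨t, rfl⟩ := hvw
  exact ⟨iterW φ k t, (iterW_append φ k v t).symm⟩

lemma iterW_perm (k : ℕ) {v w : List ℕ} (hvw : v.Perm w) :
    (iterW φ k v).Perm (iterW φ k w) := by
  induction k generalizing v w with
  | zero => exact hvw
  | succ k ih => exact ih (hvw.flatMap_right φ)

end Iterates

section Parikh

variable (m : ℕ)

lemma parikh_append (v w : List ℕ) : parikh m (v ++ w) = parikh m v + parikh m w := by
  ext; simp [parikh]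

lemma parikh_perm {v w : List ℕ} (hvw : v.Perm w) : parikh m v = parikh m w := by
  ext; simp [parikh, hvw.count_eq]

lemma perm_of_parikh_eq {v w : List ℕ} (hv : ∀ a ∈ v, a < m) (hw : ∀ a ∈ w, a < m)
    (hvw : parikh m v = parikh m w) : v.Perm w := by
  rw [List.perm_iff_count]
  intro a
  by_cases ha : a < m
  · simpa [parikh] using congrFun hvw ⟨a, ha⟩
  · rw [List.count_eq_zero_of_not_mem fun hav => ha (hv a hav),
      List.count_eq_zero_of_not_mem fun haw => ha (hw a haw)]

/-- `d` is the difference of the Parikh vectors of equally long prefixes of `B` and `A`. -/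
def IsPrefixDiff (A B : List ℕ) (d : Fin m → ℤ) : Prop :=
  ∃ i, d = parikh m (B.take i) - parikh m (A.take i)

lemma isPrefixDiff_append {A B A' B' : List ℕ} {d : Fin m → ℤ} (hlen : A.length = B.length)
    (hpar : parikh m A = parikh m B) :
    IsPrefixDiff m (A ++ A') (B ++ B') d ↔ IsPrefixDiff m A B d ∨ IsPrefixDiff m A' B' d := by
  constructor
  · rintro ⟨i, rfl⟩
    rcases le_total i A.length with hi | hi
    · exact Or.inl ⟨i, by
        rw [List.take_append_of_le_length hi, List.take_append_of_le_length (hlen ▸ hi)]⟩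
    · refine Or.inr ⟨i - A.length, ?_⟩
      rw [List.take_append, List.take_append, List.take_of_length_le hi,
        List.take_of_length_le (hlen ▸ hi), parikh_append, parikh_append, hpar, hlen]
      abel
  · rintro (⟨i, rfl⟩ | ⟨i, rfl⟩)
    · refine ⟨min i A.length, ?_⟩
      rw [List.take_append_of_le_length (min_le_right _ _),
        List.take_append_of_le_length (hlen ▸ min_le_right _ _), ← List.take_eq_take_min, hlen,
        ← List.take_eq_take_min]
    · refine ⟨A.length + i, ?_⟩
      rw [List.take_length_add_append, hlen, List.take_length_add_append, parikh_append,
        parikh_append, hpar]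
      abel

lemma isPrefixDiff_flatten {h : ℕ} {x y : Fin (h + 1) → List ℕ} {d : Fin m → ℤ}
    (hlen : ∀ j, (x j).length = (y j).length) (hpar : ∀ j, parikh m (x j) = parikh m (y j)) :
    IsPrefixDiff m (List.ofFn x).flatten (List.ofFn y).flatten d ↔
      ∃ j, IsPrefixDiff m (x j) (y j) d := by
  induction h with
  | zero => simp
  | succ h ih =>
    rw [List.ofFn_succ (f := x), List.ofFn_succ (f := y), List.flatten_cons, List.flatten_cons,
      isPrefixDiff_append m (hlen 0) (hpar 0), Fin.exists_fin_succ,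
      ih (fun j => hlen j.succ) fun j => hpar j.succ]

lemma isPrefixDiff_iff {A B : List ℕ} {d : Fin m → ℤ} (hlen : A.length = B.length) :
    IsPrefixDiff m A B d ↔ ∃ r s : List ℕ, r <+: A ∧ s <+: B ∧ r.length = s.length ∧
      d = parikh m s - parikh m r := by
  constructor
  · rintro ⟨i, rfl⟩
    exact ⟨_, _, List.take_prefix i A, List.take_prefix i B, by simp [hlen], rfl⟩
  · rintro ⟨r, s, hr, hs, hrs, rfl⟩
    refine ⟨r.length, ?_⟩
    conv_rhs => rw [← List.prefix_iff_eq_take.1 hr, hrs, ← List.prefix_iff_eq_take.1 hs]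

end Parikh

section Rotation

/-- If every `v j` starts with `p`, rotating `p` to the end of each `v j` amounts to rotating it
to the end of their concatenation. -/
lemma append_flatten_rotate (p : List ℕ) {h : ℕ} (v : Fin h → List ℕ) (hp : ∀ j, p <+: v j) :
    p ++ (List.ofFn fun j => (v j ++ p).drop p.length).flatten = (List.ofFn v).flatten ++ p := by
  induction h with
  | zero => simp
  | succ h ih =>
    obtain ⟨t, ht⟩ := hp 0
    have hrot : (v 0 ++ p).drop p.length = t ++ p := by simp [← ht]
    rw [List.ofFn_succ, List.ofFn_succ, List.flatten_cons, List.flatten_cons, hrot,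
      List.append_assoc t p, ih (fun j => v j.succ) fun j => hp j.succ, ← ht]
    simp

lemma perm_rotate {p v : List ℕ} (hp : p <+: v) : ((v ++ p).drop p.length).Perm v := by
  obtain ⟨t, rfl⟩ := hp
  simpa using List.perm_append_comm

end Rotation

/-- The word `W` followed by `u_[n]` starts with `u_[n]`, and each length `n` factor of `W u_[n]`
starting in `W` occurs in `u` at a position at most `B`. -/
def FactorsOccurBefore (u : ℕ → ℕ) (n B : ℕ) (W : List ℕ) : Prop :=
  pref u n <+: W ++ pref u n ∧
    ∀ i < W.length, ∃ j ≤ B, (W.drop i ++ pref u n).take n = factorAt u j n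

namespace FactorsOccurBefore

variable {u : ℕ → ℕ} {n B : ℕ}

lemma nil : FactorsOccurBefore u n B [] := by
  simp [FactorsOccurBefore]

lemma append {V W : List ℕ} (hV : FactorsOccurBefore u n B V)
    (hW : FactorsOccurBefore u n B W) : FactorsOccurBefore u n B (V ++ W) := by
  refine ⟨?_, fun i hi => ?_⟩
  · rw [List.append_assoc]
    exact hV.1.trans ((List.prefix_append_right_inj V).2 hW.1)
  · rcases lt_or_ge i V.length with hiV | hiV
    · obtain ⟨j, hj, hij⟩ := hV.2 i hiV
      refine ⟨j, hj, ?_⟩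
      obtain ⟨t, ht⟩ := hW.1
      rw [← hij, List.drop_append_of_le_length hiV.le, List.append_assoc, ← ht,
        ← List.append_assoc, List.take_append_of_le_length (by simp)]
    · obtain ⟨j, hj, hij⟩ := hW.2 (i - V.length) (by simp at hi; omega)
      refine ⟨j, hj, ?_⟩
      rw [← hij, List.drop_append, List.drop_of_length_le hiV, List.nil_append]

lemma iterW {φ : ℕ → List ℕ} {k : ℕ} {w : List ℕ}
    (hw : ∀ a ∈ w, FactorsOccurBefore u n B (iterW φ k [a])) :
    FactorsOccurBefore u n B (iterW φ k w) := by
  induction w with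
  | nil => rw [iterW_nil]; exact nil
  | cons a w ih =>
    rw [← List.singleton_append, iterW_append]
    exact (hw a (by simp)).append (ih fun b hb => hw b (by simp [hb]))

lemma of_prefix {W : List ℕ} (hW : W ++ pref u n = pref u (W.length + n))
    (hB : W.length ≤ B) : FactorsOccurBefore u n B W := by
  refine ⟨hW ▸ pref_prefix_pref u (by omega), fun i hi => ⟨i, by omega, ?_⟩⟩
  rw [← List.drop_append_of_le_length hi.le, hW, pref_eq_factorAt, drop_factorAt, take_factorAt,
    min_eq_left (by omega), zero_add]

end FactorsOccurBefore

/-- The prefix `u_[n]` reappears in `u` right after `φ^P(0)`, for all `P` exceeding by at least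
some `e` the exponents `N` with `n ≤ |φ^N(0)|`. -/
lemma exists_iterW_append_prefix
    (m : ℕ) (hm : 2 ≤ m) (α : ℕ → ℕ) (hα0 : 1 ≤ α 0) (hαlast : 1 ≤ α (m - 1))
    (φ : ℕ → List ℕ)
    (hφ : ∀ ℓ, ℓ + 1 < m → φ ℓ = List.replicate (α ℓ) 0 ++ [ℓ + 1])
    (hφlast : φ (m - 1) = List.replicate (α (m - 1)) 0)
    (R : ℕ)
    (hR : R = if 2 ≤ α 0 then m - 1 else m + sInf {ℓ : ℕ | 1 ≤ ℓ ∧ 1 ≤ α ℓ} - 1)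
    (hmono : ∀ {a b : ℕ}, a ≤ b → iterW φ a [0] <+: iterW φ b [0]) :
    ∃ e, R = m - 1 + e ∧ ∀ N P, N + e ≤ P →
      iterW φ P [0] ++ iterW φ N [0] <+: iterW φ (P + 1) [0] := by
  split_ifs at hR with h2
  · refine ⟨0, hR, fun N P hP => ?_⟩
    obtain ⟨c, hc⟩ := Nat.exists_eq_add_of_le h2
    have h0 : φ 0 = [0] ++ ([0] ++ (List.replicate c 0 ++ [1])) := by
      rw [hφ 0 (by omega), hc, add_comm]
      simp [List.replicate_succ]
    rw [iterW_succ_singleton, h0, iterW_append, iterW_append, List.prefix_append_right_inj]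
    exact (hmono hP).trans (List.prefix_append _ _)
  · set e := sInf {ℓ : ℕ | 1 ≤ ℓ ∧ 1 ≤ α ℓ}
    have hmem : m - 1 ∈ {ℓ : ℕ | 1 ≤ ℓ ∧ 1 ≤ α ℓ} := ⟨by omega, hαlast⟩
    have hspec : 1 ≤ e ∧ 1 ≤ α e := Nat.sInf_mem ⟨_, hmem⟩
    have hem : e ≤ m - 1 := Nat.sInf_le hmem
    have hzero : ∀ ℓ, 1 ≤ ℓ → ℓ < e → α ℓ = 0 := fun ℓ h1 hlt => by
      by_contra hne
      exact Nat.notMem_of_lt_sInf hlt ⟨h1, Nat.one_le_iff_ne_zero.2 hne⟩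
    have hstep : ∀ d ℓ, 1 ≤ ℓ → ℓ + d = e → [0] <+: iterW φ (d + 1) [ℓ] := by
      intro d
      induction d with
      | zero =>
        intro ℓ _ hℓ
        rw [add_zero] at hℓ
        obtain ⟨c, hc⟩ := Nat.exists_eq_add_of_le hspec.2
        have hhead : [0] <+: List.replicate (α ℓ) 0 := by
          rw [← hℓ] at hc
          rw [hc, add_comm, List.replicate_succ]
          simp
        rw [iterW_succ_singleton]
        change [0] <+: φ ℓ
        by_cases hlast : ℓ = m - 1
        · rw [hlast, hφlast, ← hlast]
          exact hhead
        · rw [hφ ℓ (by omega)]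
          exact hhead.trans (List.prefix_append _ _)
      | succ d ih =>
        intro ℓ h1 hℓ
        rw [iterW_succ_singleton, hφ ℓ (by omega), hzero ℓ h1 (by omega)]
        exact ih (ℓ + 1) (by omega) (by omega)
    have hone : [0] <+: iterW φ e [1] := by
      have := hstep (e - 1) 1 le_rfl (by omega)
      rwa [Nat.sub_add_cancel hspec.1] at this
    refine ⟨e, by omega, fun N P hP => ?_⟩
    have h0 : φ 0 = [0] ++ [1] := by
      rw [hφ 0 (by omega), show α 0 = 1 by omega]
      rfl
    rw [iterW_succ_singleton, h0, iterW_append, List.prefix_append_right_inj]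
    obtain ⟨P', rfl⟩ : ∃ P', P = P' + e := ⟨P - e, by omega⟩
    rw [iterW_add φ P' e [1]]
    exact (hmono (by omega)).trans (iterW_prefix φ P' hone)

theorem stmt12
    (m : ℕ) (hm : 2 ≤ m) (α : ℕ → ℕ) (hα0 : 1 ≤ α 0)
    (hαle : ∀ ℓ, ℓ < m → α ℓ ≤ α 0) (hαlast : 1 ≤ α (m - 1))
    (φ : ℕ → List ℕ)
    (hφ : ∀ ℓ, ℓ + 1 < m → φ ℓ = List.replicate (α ℓ) 0 ++ [ℓ + 1])
    (hφlast : φ (m - 1) = List.replicate (α (m - 1)) 0)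
    (u : ℕ → ℕ) (hu : ∀ i, u i < m)
    (hufix : ∀ k : ℕ, iterW φ k [0] = pref u (iterW φ k [0]).length)
    (R : ℕ)
    (hR : R = if 2 ≤ α 0 then m - 1 else m + sInf {ℓ : ℕ | 1 ≤ ℓ ∧ 1 ≤ α ℓ} - 1)
    (k K n Q q : ℕ)
    (hn : n ≤ (iterW φ (k + K) [0]).length) (hQ : Q ≤ (iterW φ K [0]).length)
    (hfact : pref u n = iterW φ k (pref u Q) ++ pref u q)
    (h : ℕ) (z zt : Fin (h + 1) → List ℕ)
    (hzne : ∀ j, z j ≠ []) (hztne : ∀ j, zt j ≠ [])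
    (hzjoin : (List.ofFn z).flatten = iterW φ (K + R) [0])
    (hztjoin : (List.ofFn zt).flatten = (iterW φ (K + R) [0] ++ pref u Q).drop Q)
    (hpsi : ∀ j, parikh m (z j) = parikh m (zt j))
    (hqpref : ∀ j, pref u q <+: iterW φ k (zt j)) :
    iterW φ (k + K + R) [0] = (List.ofFn fun j => iterW φ k (z j)).flatten ∧
    (iterW φ (k + K + R) [0] ++ pref u n).drop n =
      (List.ofFn fun j => (iterW φ k (zt j) ++ pref u q).drop q).flatten ∧
    (∀ j, parikh m (iterW φ k (z j)) =
      parikh m ((iterW φ k (zt j) ++ pref u q).drop q)) ∧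
    relParikhSet m u n =
      ⋃ j : Fin (h + 1), { d : Fin m → ℤ | ∃ r s : List ℕ,
        r <+: iterW φ k (z j) ∧ s <+: (iterW φ k (zt j) ++ pref u q).drop q ∧
        r.length = s.length ∧ d = parikh m s - parikh m r } := by
  have hmono : ∀ {a b : ℕ}, a ≤ b → iterW φ a [0] <+: iterW φ b [0] := by
    intro a b hab
    obtain ⟨c, rfl⟩ := Nat.exists_eq_add_of_le hab
    rw [iterW_add]
    refine iterW_prefix φ a ?_
    induction c with
    | zero => exact List.prefix_rfl
    | succ c ih =>
      obtain ⟨t, ht⟩ := Nat.exists_eq_add_of_le hα0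
      have h0 : φ 0 = [0] ++ (List.replicate t 0 ++ [1]) := by
        rw [hφ 0 (by omega), ht, add_comm]
        simp [List.replicate_succ]
      rw [iterW_succ_singleton, h0, iterW_append]
      exact (ih (by omega)).trans (List.prefix_append _ _)
  obtain ⟨e, hRe, he⟩ := exists_iterW_append_prefix m hm α hα0 hαlast φ hφ hφlast R hR hmono
  have hlen_mono : ∀ {a b : ℕ}, a ≤ b → (iterW φ a [0]).length ≤ (iterW φ b [0]).length :=
    fun hab => (hmono hab).length_le
  have hletters : ∀ t, ∀ a ∈ pref u t, a < m := by
    intro t a ha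
    simp only [pref, List.mem_map] at ha
    obtain ⟨i, -, rfl⟩ := ha
    exact hu i
  have hletters_iter : ∀ t, ∀ a ∈ iterW φ t [0], a < m := fun t a ha =>
    hletters _ a (hufix t ▸ ha)
  have hpre : ∀ P, k + K + e ≤ P →
      iterW φ P [0] ++ pref u n = pref u ((iterW φ P [0]).length + n) := by
    intro P hP
    have hn' : pref u n <+: iterW φ (k + K) [0] := by
      rw [hufix (k + K)]
      exact pref_prefix_pref u hn
    have hp := ((List.prefix_append_right_inj (iterW φ P [0])).2 hn').trans (he (k + K) P hP)
    rw [hufix (P + 1)] at hp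
    simpa using eq_pref_of_prefix hp
  set F := (iterW φ (k + K + R) [0]).length with hF
  have hgood0 : ∀ P, k + K + e ≤ P → P ≤ k + K + R →
      FactorsOccurBefore u n F (iterW φ P [0]) := fun P hP hPM =>
    .of_prefix (hpre P hP) (hlen_mono hPM)
  have hgood_replicate : ∀ P c, k + K + e ≤ P → P ≤ k + K + R →
      FactorsOccurBefore u n F (iterW φ P (List.replicate c 0)) := fun P c hP hPM =>
    .iterW fun a ha => by
      rw [List.eq_of_mem_replicate ha]
      exact hgood0 P hP hPM
  have hgood : ∀ d a P, 1 ≤ a → a + d = m - 1 → k + K + e + d + 1 ≤ P → P ≤ k + K + R →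
      FactorsOccurBefore u n F (iterW φ P [a]) := by
    intro d
    induction d with
    | zero =>
      intro a P _ had hP hPM
      obtain ⟨P, rfl⟩ : ∃ P', P = P' + 1 := ⟨P - 1, by omega⟩
      rw [add_zero] at had
      rw [iterW_succ_singleton, had, hφlast]
      exact hgood_replicate P _ (by omega) (by omega)
    | succ d ih =>
      intro a P ha had hP hPM
      obtain ⟨P, rfl⟩ : ∃ P', P = P' + 1 := ⟨P - 1, by omega⟩
      rw [iterW_succ_singleton, hφ a (by omega), iterW_append]
      exact (hgood_replicate P _ (by omega) (by omega)).append
        (ih (a + 1) P (by omega) (by omega) (by omega) (by omega))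
  have hgood_letter : ∀ a < m, FactorsOccurBefore u n F (iterW φ (k + K + R) [a]) := by
    intro a ha
    rcases Nat.eq_zero_or_pos a with rfl | hpos
    · exact hgood0 _ (by omega) le_rfl
    · exact hgood (m - 1 - a) a _ hpos (by omega) (by omega) le_rfl
  have hunbounded : ∀ t, t ≤ (iterW φ (e + t) [0]).length := by
    intro t
    induction t with
    | zero => exact Nat.zero_le _
    | succ t ih =>
      have := (he 0 (e + t) (by omega)).length_le
      rw [List.length_append, show (iterW φ 0 [0]).length = 1 from rfl, add_assoc] at this
      omega
  have hoccur : ∀ i, ∃ j ≤ F, factorAt u i n = factorAt u j n := by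
    intro i
    have hlong : i + n + 1 ≤ (iterW φ (k + K + R + (e + (i + n + 1))) [0]).length :=
      (hunbounded (i + n + 1)).trans (hlen_mono (by omega))
    have hg : FactorsOccurBefore u n F (iterW φ (k + K + R + (e + (i + n + 1))) [0]) := by
      rw [iterW_add]
      exact .iterW fun a ha => hgood_letter a (hletters_iter _ a ha)
    obtain ⟨j, hj, hij⟩ := hg.2 i (by omega)
    refine ⟨j, hj, ?_⟩
    rw [← hij, List.take_append_of_le_length (by simp; omega), hufix, pref_eq_factorAt,
      drop_factorAt, take_factorAt, min_eq_left (by omega), zero_add]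
  have hjoin : iterW φ (k + K + R) [0] = (List.ofFn fun j => iterW φ k (z j)).flatten := by
    rw [add_assoc, iterW_add, ← hzjoin, iterW_flatten, List.map_ofFn]
    rfl
  have hnlen : n = (iterW φ k (pref u Q)).length + q := by
    simpa using congrArg List.length hfact
  have hQpre : pref u Q ++ (List.ofFn zt).flatten = iterW φ (K + R) [0] ++ pref u Q := by
    have hQ' : pref u Q <+: iterW φ (K + R) [0] ++ pref u Q := by
      refine List.IsPrefix.trans ?_ (List.prefix_append _ _)
      rw [hufix (K + R)]
      exact pref_prefix_pref u (hQ.trans (hlen_mono (by omega)))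
    obtain ⟨t, ht⟩ := hQ'
    rw [hztjoin, ← ht]
    simp
  have hrot : pref u n ++ (List.ofFn fun j => (iterW φ k (zt j) ++ pref u q).drop q).flatten =
      iterW φ (k + K + R) [0] ++ pref u n := by
    have hr := append_flatten_rotate (pref u q) (fun j => iterW φ k (zt j)) hqpref
    simp only [length_pref] at hr
    have hk := congrArg (iterW φ k) hQpre
    rw [iterW_append, iterW_append, iterW_flatten, List.map_ofFn, ← iterW_add, ← add_assoc] at hk
    rw [hfact, List.append_assoc, hr, ← List.append_assoc, ← List.append_assoc, ← hk]
    rfl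
  have hdrop : (iterW φ (k + K + R) [0] ++ pref u n).drop n =
      (List.ofFn fun j => (iterW φ k (zt j) ++ pref u q).drop q).flatten := by
    rw [← hrot, List.drop_left' (length_pref u n)]
  have hperm : ∀ j, (iterW φ k (z j)).Perm ((iterW φ k (zt j) ++ pref u q).drop q) := by
    intro j
    have hz : ∀ a ∈ z j, a < m := fun a ha => hletters_iter (K + R) a <| by
      rw [← hzjoin]
      exact List.mem_flatten.2 ⟨z j, List.mem_ofFn.2 ⟨j, rfl⟩, ha⟩
    have hzt : ∀ a ∈ zt j, a < m := fun a ha => by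
      have hmem : a ∈ (List.ofFn zt).flatten :=
        List.mem_flatten.2 ⟨zt j, List.mem_ofFn.2 ⟨j, rfl⟩, ha⟩
      rw [hztjoin] at hmem
      rcases List.mem_append.1 (List.mem_of_mem_drop hmem) with h1 | h1
      · exact hletters_iter _ a h1
      · exact hletters _ a h1
    have hr := perm_rotate (hqpref j)
    rw [length_pref] at hr
    exact (iterW_perm φ k (perm_of_parikh_eq m hz hzt (hpsi j))).trans hr.symm
  have hparikh : ∀ j, parikh m (iterW φ k (z j)) =
      parikh m ((iterW φ k (zt j) ++ pref u q).drop q) := fun j => parikh_perm m (hperm j)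
  refine ⟨hjoin, hdrop, hparikh, ?_⟩
  have hdiff : ∀ i ≤ F, parikh m (factorAt u i n) - parikh m (pref u n) =
      parikh m (((iterW φ (k + K + R) [0] ++ pref u n).drop n).take i) -
        parikh m ((iterW φ (k + K + R) [0]).take i) := by
    intro i hi
    have h1 : ((iterW φ (k + K + R) [0] ++ pref u n).drop n).take i = factorAt u n i := by
      rw [hpre _ (by omega), pref_eq_factorAt, drop_factorAt, take_factorAt, zero_add,
        min_eq_left (by omega)]
    have h2 : (iterW φ (k + K + R) [0]).take i = pref u i := by
      rw [hufix, pref_eq_factorAt, take_factorAt, min_eq_left hi, pref_eq_factorAt]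
    have h3 := congrArg (parikh m) (pref_add u i n)
    rw [add_comm, pref_add, parikh_append, parikh_append] at h3
    rw [h1, h2, sub_eq_sub_iff_add_eq_add, add_comm, ← h3, add_comm]
  ext d
  simp only [Set.mem_iUnion, Set.mem_ofPred_eq, ← isPrefixDiff_iff m (hperm _).length_eq]
  rw [← isPrefixDiff_flatten m (fun j => (hperm j).length_eq) hparikh, ← hjoin, ← hdrop]
  constructor
  · rintro ⟨w, ⟨i, hw⟩, hwn, rfl⟩
    obtain ⟨j, hj, hij⟩ := hoccur i
    have hw' : w = factorAt u j n := by
      rw [← hij, ← hwn]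
      exact hw
    exact ⟨j, by rw [hw', hdiff j hj]⟩
  · rintro ⟨i, rfl⟩
    refine ⟨factorAt u (min i F) n, ⟨min i F, by rw [length_factorAt]; rfl⟩, by simp, ?_⟩
    rw [hdiff _ (min_le_right _ _)]
    conv_rhs => rw [hF, ← List.take_eq_take_min]
    congr 2
    rw [List.take_eq_take_min, List.length_drop, List.length_append, length_pref,
      Nat.add_sub_cancel]
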